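/- Let n ≥ 1 be an integer, μ > 0 a real number, and F(θ) = √(∑_{k=0}^{n−1} (cos θ)^{2k}). Consider the planar vector field G(θ,T) = ( −6μ·F(θ)·(T − cos θ)/n − 3F(θ)²·sin(2θ)/(2n) , 3T(1−(cos θ)^{2n})/n ) on ℝ². Then the point (θ,T) = (0,1) is an equilibrium of G and it is unstable (it is not Lyapunov stable). -/

import Mathlib

open Real Filter

noncomputable section

/-- Lyapunov stability of the equilibrium `p` of the vector field `X` on the domain `D`. -/
def LyapunovStable {E : Type*} [NormedAddCommGroup E] [NormedSpace ℝ E]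
    (X : E → E) (D : Set E) (p : E) : Prop :=
  ∀ ε > 0, ∃ δ > 0, ∀ γ : ℝ → E,
    (∀ t : ℝ, 0 ≤ t → γ t ∈ D) →
    (∀ t : ℝ, 0 ≤ t → HasDerivAt γ (X (γ t)) t) →
    ‖γ 0 - p‖ < δ → ∀ t : ℝ, 0 ≤ t → ‖γ t - p‖ < ε

/-- `F θ = √(∑_{k=0}^{n-1} (cos θ)^{2k})`. -/
def F (n : ℕ) (θ : ℝ) : ℝ :=
  Real.sqrt (∑ k ∈ Finset.range n, Real.cos θ ^ (2 * k))

/-- The unwrapped vector field near the de Sitter point dS₊ (flat, Λ = 0, detailed balance,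
E-model potential); coordinates `(θ, T)`. -/
def G3 (n : ℕ) (μ : ℝ) (p : ℝ × ℝ) : ℝ × ℝ :=
  (-6 * μ * F n p.1 * (p.2 - Real.cos p.1) / n
      - 3 * F n p.1 ^ 2 * Real.sin (2 * p.1) / (2 * n),
   3 * p.2 * (1 - Real.cos p.1 ^ (2 * n)) / n)

open Manifold in
/-- A `C¹` vector field of at most linear growth on a finite-dimensional space is complete. -/
lemma exists_global_solution_of_linear_growth {E : Type*} [NormedAddCommGroup E]
    [NormedSpace ℝ E] [FiniteDimensional ℝ E] {v : E → E} (hv : ContDiff ℝ 1 v) {C : ℝ}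
    (hC : 0 < C) (hb : ∀ x, ‖v x‖ ≤ C * (‖x‖ + 1)) (x : E) :
    ∃ γ : ℝ → E, γ 0 = x ∧ ∀ t, HasDerivAt γ (v (γ t)) t := by
  have : CompleteSpace E := FiniteDimensional.complete ℝ E
  have : ProperSpace E := FiniteDimensional.proper ℝ E
  have hloc : ∀ x : E, ∃ γ : ℝ → E, γ 0 = x ∧
      ∀ t ∈ Set.Ioo (-(1 / (2 * C))) (1 / (2 * C)), HasDerivAt γ (v (γ t)) t := by
    intro x
    obtain ⟨K, hK⟩ := hv.locallyLipschitz.locallyLipschitzOn.exists_lipschitzOnWith_of_compact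
      (isCompact_closedBall x (‖x‖ + 1))
    have hpos : 0 ≤ 1 / (2 * C) := by positivity
    have hpl : IsPicardLindelof (fun _ : ℝ ↦ v)
        (tmin := -(1 / (2 * C))) (tmax := 1 / (2 * C))
        ⟨0, by constructor <;> linarith⟩ x
        ⟨‖x‖ + 1, by positivity⟩ 0 ⟨2 * C * (‖x‖ + 1), by positivity⟩ K := by
      refine IsPicardLindelof.of_time_independent (fun y hy ↦ ?_) hK ?_
      · have h1 : ‖y - x‖ ≤ ‖x‖ + 1 := by rwa [mem_closedBall_iff_norm] at hy
        have h2 : ‖y‖ ≤ ‖y - x‖ + ‖x‖ := by simpa using norm_add_le (y - x) x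
        refine (hb y).trans ?_
        change C * (‖y‖ + 1) ≤ 2 * C * (‖x‖ + 1)
        nlinarith
      · change 2 * C * (‖x‖ + 1) * max (1 / (2 * C) - 0) (0 - -(1 / (2 * C))) ≤ ‖x‖ + 1 - 0
        rw [sub_zero, zero_sub, neg_neg, max_self, sub_zero]
        field_simp
        exact le_rfl
    obtain ⟨γ, h0, hγ⟩ := hpl.exists_eq_forall_mem_Icc_hasDerivWithinAt₀
    exact ⟨γ, h0, fun t ht ↦
      (hγ t (Set.Ioo_subset_Icc_self ht)).hasDerivAt (Icc_mem_nhds ht.1 ht.2)⟩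
  obtain ⟨γ, h0, hγ⟩ := exists_isMIntegralCurve_of_isMIntegralCurveOn (I := 𝓘(ℝ, E)) (v := v)
    (contMDiff_vectorSpace_iff_contDiff.mpr hv) (ε := 1 / (2 * C)) (by positivity)
    (fun y ↦ by
      obtain ⟨γ, h0, hγ⟩ := hloc y
      exact ⟨γ, h0, fun t ht ↦ (hγ t ht).hasFDerivAt.hasMFDerivAt.hasMFDerivWithinAt⟩) x
  exact ⟨γ, h0, fun t ↦ (hγ t).hasFDerivAt⟩

/-- A function whose derivative is at least `c` on `[0, ∞)` grows at least linearly. -/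
lemma add_mul_le_of_le_hasDerivAt {f f' : ℝ → ℝ} {c : ℝ}
    (hf : ∀ t, 0 ≤ t → HasDerivAt f (f' t) t) (hc : ∀ t, 0 ≤ t → c ≤ f' t) {t : ℝ} (ht : 0 ≤ t) :
    f 0 + c * t ≤ f t := by
  have h := (convex_Ici (0 : ℝ)).mul_sub_le_image_sub_of_le_deriv (f := f) (C := c)
    (fun s hs ↦ (hf s hs).continuousAt.continuousWithinAt)
    (fun s hs ↦ (hf s (interior_subset hs)).differentiableAt.differentiableWithinAt)
    (fun s hs ↦ by
      have hs' : 0 ≤ s := interior_subset hs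
      rw [(hf s hs').deriv]
      exact hc s hs')
    0 Set.self_mem_Ici t ht ht
  linarith

lemma one_le_sum_cos_pow {n : ℕ} (hn : 1 ≤ n) (θ : ℝ) :
    1 ≤ ∑ k ∈ Finset.range n, Real.cos θ ^ (2 * k) := by
  have h := Finset.single_le_sum (f := fun k ↦ Real.cos θ ^ (2 * k))
    (fun k _ ↦ by rw [pow_mul]; positivity) (Finset.mem_range.mpr hn)
  simpa using h

lemma sum_cos_pow_le (n : ℕ) (θ : ℝ) :
    ∑ k ∈ Finset.range n, Real.cos θ ^ (2 * k) ≤ n := by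
  calc _ ≤ ∑ _k ∈ Finset.range n, (1 : ℝ) := Finset.sum_le_sum fun k _ ↦ by
        rw [pow_mul]; exact pow_le_one₀ (sq_nonneg _) (Real.cos_sq_le_one θ)
    _ = n := by simp

lemma F_sq (n : ℕ) (θ : ℝ) : F n θ ^ 2 = ∑ k ∈ Finset.range n, Real.cos θ ^ (2 * k) :=
  Real.sq_sqrt (Finset.sum_nonneg fun k _ ↦ by rw [pow_mul]; positivity)

lemma F_sq_le (n : ℕ) (θ : ℝ) : F n θ ^ 2 ≤ n := (F_sq n θ).trans_le (sum_cos_pow_le n θ)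

lemma one_le_F {n : ℕ} (hn : 1 ≤ n) (θ : ℝ) : 1 ≤ F n θ :=
  Real.one_le_sqrt.mpr (one_le_sum_cos_pow hn θ)

lemma one_sub_cos_pow_eq (n : ℕ) (θ : ℝ) :
    1 - Real.cos θ ^ (2 * n) = F n θ ^ 2 * Real.sin θ ^ 2 := by
  have h := geom_sum_mul (Real.cos θ ^ 2) n
  simp only [← pow_mul] at h
  rw [F_sq, Real.sin_sq]
  linarith

lemma contDiff_F {n : ℕ} (hn : 1 ≤ n) : ContDiff ℝ 1 (F n) := by
  refine ContDiff.sqrt ?_ fun θ ↦ (zero_lt_one.trans_le (one_le_sum_cos_pow hn θ)).ne'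
  fun_prop

lemma contDiff_G3 {n : ℕ} (hn : 1 ≤ n) (μ : ℝ) : ContDiff ℝ 1 (G3 n μ) := by
  have hF := contDiff_F hn
  unfold G3
  fun_prop

lemma norm_G3_le {n : ℕ} (hn : 1 ≤ n) {μ : ℝ} (hμ : 0 < μ) (p : ℝ × ℝ) :
    ‖G3 n μ p‖ ≤ (6 * μ + 3) * (‖p‖ + 1) := by
  obtain ⟨θ, T⟩ := p
  have hn' : (1 : ℝ) ≤ n := by exact_mod_cast hn
  have hn0 : (0 : ℝ) < n := by linarith
  have hT : |T| ≤ ‖(θ, T)‖ := norm_snd_le (θ, T)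
  have hF1 := one_le_F hn θ
  have hF2 := F_sq_le n θ
  have hFn : F n θ / n ≤ 1 := by rw [div_le_one hn0]; nlinarith
  have hFn2 : F n θ ^ 2 / n ≤ 1 := by rwa [div_le_one hn0]
  have hFn0 : 0 ≤ F n θ / n := by positivity
  have hFn20 : 0 ≤ F n θ ^ 2 / n := by positivity
  refine max_le ?_ ?_
  · have e : (G3 n μ (θ, T)).1 = (F n θ / n) * (-(6 * μ) * (T - Real.cos θ)) +
        (F n θ ^ 2 / n) * (-(3 / 2) * Real.sin (2 * θ)) := by
      simp only [G3]; field_simp; ring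
    have h1 : |T - Real.cos θ| ≤ |T| + 1 :=
      (abs_sub _ _).trans (by linarith [Real.abs_cos_le_one θ])
    have h2 := Real.abs_sin_le_one (2 * θ)
    rw [e, Real.norm_eq_abs]
    refine (abs_add_le _ _).trans ?_
    simp only [abs_mul, abs_neg, abs_of_nonneg hFn0, abs_of_nonneg hFn20, abs_of_pos hμ]
    norm_num only [abs_of_pos]
    have h3 : F n θ / n * (6 * μ * |T - Real.cos θ|) ≤ 6 * μ * (|T| + 1) :=
      (mul_le_of_le_one_left (by positivity) hFn).trans (by gcongr)
    have h4 : F n θ ^ 2 / n * (3 / 2 * |Real.sin (2 * θ)|) ≤ 3 / 2 * 1 :=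
      (mul_le_of_le_one_left (by positivity) hFn2).trans (by gcongr)
    nlinarith [abs_nonneg T]
  · have e : (G3 n μ (θ, T)).2 = (F n θ ^ 2 / n) * (3 * T * Real.sin θ ^ 2) := by
      simp only [G3, one_sub_cos_pow_eq]; ring
    have h1 := Real.sin_sq_le_one θ
    rw [e, Real.norm_eq_abs]
    simp only [abs_mul, abs_of_nonneg hFn20, abs_of_nonneg (sq_nonneg (Real.sin θ))]
    norm_num only [abs_of_pos]
    have h3 : F n θ ^ 2 / n * (3 * |T| * Real.sin θ ^ 2) ≤ 3 * |T| * 1 :=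
      (mul_le_of_le_one_left (by positivity) hFn2).trans (by gcongr)
    nlinarith [abs_nonneg T]

lemma G3_snd_nonneg (n : ℕ) (μ : ℝ) {p : ℝ × ℝ} (hT : 0 ≤ p.2) : 0 ≤ (G3 n μ p).2 := by
  simp only [G3, one_sub_cos_pow_eq]
  positivity

/-- Above the line `T = 1 + d`, the function `T - K θ` with `K = 4 μ d / n` grows at a
uniformly positive rate along the flow. -/
lemma le_G3_snd_sub_mul_fst {n : ℕ} (hn : 1 ≤ n) {μ d : ℝ} (hμ : 0 < μ) (hd : 0 < d)
    {p : ℝ × ℝ} (hT : 1 + d ≤ p.2) :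
    12 * μ ^ 2 * d ^ 2 / (n : ℝ) ^ 2 ≤
      (G3 n μ p).2 - 4 * μ * d / n * (G3 n μ p).1 := by
  obtain ⟨θ, T⟩ := p
  simp only at hT
  have hn' : (1 : ℝ) ≤ n := by exact_mod_cast hn
  have hn0 : (0 : ℝ) < n := by linarith
  have hF1 := one_le_F hn θ
  have hF2 := F_sq_le n θ
  set K := 4 * μ * d / n with hK
  have hK0 : 0 < K := by positivity
  have hKn : K * n = 4 * μ * d := by rw [hK]; field_simp
  have e : (G3 n μ (θ, T)).2 - K * (G3 n μ (θ, T)).1 =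
      3 / n * (T * (F n θ ^ 2 * Real.sin θ ^ 2) + K * (2 * μ * F n θ * (T - Real.cos θ)
        + F n θ ^ 2 * (Real.sin θ * Real.cos θ))) := by
    simp only [G3, one_sub_cos_pow_eq, Real.sin_two_mul]
    field_simp
    ring
  have e' : 12 * μ ^ 2 * d ^ 2 / (n : ℝ) ^ 2 = 3 / n * (K * (μ * d)) := by
    rw [hK]; field_simp; ring
  rw [e, e']
  refine mul_le_mul_of_nonneg_left ?_ (by positivity)
  have h1 : F n θ ^ 2 * Real.sin θ ^ 2 ≤ T * (F n θ ^ 2 * Real.sin θ ^ 2) :=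
    le_mul_of_one_le_left (by positivity) (by linarith)
  have h2 : 2 * μ * d ≤ 2 * μ * F n θ * (T - Real.cos θ) := by
    have hc := Real.cos_le_one θ
    calc 2 * μ * d = 2 * μ * 1 * d := by ring
      _ ≤ _ := by gcongr; linarith
  have h3 : -(K ^ 2 / 4) ≤ Real.sin θ ^ 2 + K * (Real.sin θ * Real.cos θ) := by
    nlinarith [sq_nonneg (Real.sin θ + K / 2 * Real.cos θ), Real.cos_sq_le_one θ, sq_nonneg K]
  have h4 := mul_le_mul_of_nonneg_left h3 (sq_nonneg (F n θ))
  have h5 : F n θ ^ 2 * (K ^ 2 / 4) ≤ K * (μ * d) := by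
    calc _ ≤ (n : ℝ) * (K ^ 2 / 4) := by gcongr
      _ = K * (K * n) / 4 := by ring
      _ = _ := by rw [hKn]; ring
  nlinarith [mul_le_mul_of_nonneg_left h2 hK0.le]

theorem stmt_3 (n : ℕ) (hn : 1 ≤ n) (μ : ℝ) (hμ : 0 < μ) :
    G3 n μ (0, 1) = (0, 0) ∧
      ¬ LyapunovStable (G3 n μ) (Set.univ : Set (ℝ × ℝ)) (0, 1) := by
  refine ⟨by simp [G3], fun hstab ↦ ?_⟩
  obtain ⟨δ, hδ, hstab⟩ := hstab (1 / 2) (by norm_num)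
  obtain ⟨γ, h0, hγ⟩ := exists_global_solution_of_linear_growth (contDiff_G3 hn μ)
    (by positivity) (norm_G3_le hn hμ) (0, 1 + δ / 2)
  have hnear := hstab γ (fun _ _ ↦ Set.mem_univ _) (fun t _ ↦ hγ t) (by
    rw [h0]
    simpa [Prod.norm_def, abs_of_pos hδ] using hδ)
  have hθ : ∀ t, 0 ≤ t → |(γ t).1| < 1 / 2 := fun t ht ↦ by
    simpa using (norm_fst_le (γ t - (0, 1))).trans_lt (hnear t ht)
  have hT : ∀ t, 0 ≤ t → |(γ t).2 - 1| < 1 / 2 := fun t ht ↦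
    (norm_snd_le (γ t - (0, 1))).trans_lt (hnear t ht)
  have hder1 : ∀ t, HasDerivAt (fun t ↦ (γ t).1) (G3 n μ (γ t)).1 t := fun t ↦ (hγ t).fst
  have hder2 : ∀ t, HasDerivAt (fun t ↦ (γ t).2) (G3 n μ (γ t)).2 t := fun t ↦ (hγ t).snd
  have hTlow : ∀ t, 0 ≤ t → 1 + δ / 2 ≤ (γ t).2 := fun t ht ↦ by
    have h := add_mul_le_of_le_hasDerivAt (c := 0) (fun t _ ↦ hder2 t)
      (fun t ht ↦ G3_snd_nonneg n μ (by linarith [(abs_lt.mp (hT t ht)).1])) ht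
    simpa [h0] using h
  have hn0 : (0 : ℝ) < n := by exact_mod_cast hn
  set K := 4 * μ * (δ / 2) / n with hK
  set κ := 12 * μ ^ 2 * (δ / 2) ^ 2 / (n : ℝ) ^ 2 with hκ
  have hK0 : 0 < K := by positivity
  have hκ0 : 0 < κ := by positivity
  have ht : 0 ≤ (3 / 2 + K / 2) / κ := by positivity
  have hgrow := add_mul_le_of_le_hasDerivAt (c := κ)
    (fun t _ ↦ (hder2 t).sub ((hder1 t).const_mul K))
    (fun t ht ↦ le_G3_snd_sub_mul_fst hn hμ (half_pos hδ) (hTlow t ht)) ht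
  rw [mul_div_cancel₀ _ hκ0.ne'] at hgrow
  simp only [Pi.sub_apply, h0] at hgrow
  have h1 := (abs_lt.mp (hθ _ ht)).1
  have h2 := (abs_lt.mp (hT _ ht)).2
  nlinarith
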